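/- For |q|<1, q²·ψ⁴(q)·ψ⁴(q³) = (1/10)·∑_{j≥1} ( j³q^j/(1−q^j) − j³q^{2j}/(1−q^{2j}) + 9j³q^{3j}/(1−q^{3j}) − 9j³q^{6j}/(1−q^{6j}) ) − (1/10)·η₁²η₂²η₃²η₆², where η_m = q^{m/24}∏_{n≥1}(1−q^{mn}). -/

import Mathlib

noncomputable section

open Filter Topology

/-- The infinite `q`-Pochhammer symbol `(a; q)_∞`. -/
def qPoch (a q : ℂ) : ℂ := ∏' n : ℕ, (1 - a * q ^ n)

/-- The Euler product `(q; q)_∞`. -/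
def eulerProd (q : ℂ) : ℂ := qPoch q q

lemma summable_norm_mul_pow (a : ℂ) {q : ℂ} (hq : ‖q‖ < 1) :
    Summable fun n : ℕ => ‖-(a * q ^ n)‖ := by
  simpa using (summable_geometric_of_lt_one (norm_nonneg q) hq).mul_left ‖a‖

lemma multipliable_qPoch (a : ℂ) {q : ℂ} (hq : ‖q‖ < 1) :
    Multipliable fun n : ℕ => 1 - a * q ^ n := by
  simpa [sub_eq_add_neg] using multipliable_one_add_of_summable (summable_norm_mul_pow a hq)

lemma qPoch_ne_zero {a q : ℂ} (hq : ‖q‖ < 1) (h : ∀ n : ℕ, 1 - a * q ^ n ≠ 0) :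
    qPoch a q ≠ 0 := by
  have := tprod_one_add_ne_zero_of_summable (f := fun n : ℕ => -(a * q ^ n))
    (by simpa [sub_eq_add_neg] using h) (summable_norm_mul_pow a hq)
  simpa [qPoch, sub_eq_add_neg] using this

lemma one_sub_ne_zero_of_norm_lt_one {x : ℂ} (hx : ‖x‖ < 1) : 1 - x ≠ 0 := by
  intro h
  rw [← sub_eq_zero.mp h] at hx
  simp at hx

lemma norm_mul_pow_lt_one {a q : ℂ} (ha : ‖a‖ < 1) (hq : ‖q‖ < 1) (n : ℕ) :
    ‖a * q ^ n‖ < 1 := by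
  rw [norm_mul, norm_pow]
  exact (mul_le_of_le_one_right (norm_nonneg a) (pow_le_one₀ (norm_nonneg q) hq.le)).trans_lt ha

lemma qPoch_ne_zero_of_norm_lt_one {a q : ℂ} (ha : ‖a‖ < 1) (hq : ‖q‖ < 1) : qPoch a q ≠ 0 :=
  qPoch_ne_zero hq fun n => one_sub_ne_zero_of_norm_lt_one (norm_mul_pow_lt_one ha hq n)

lemma eulerProd_ne_zero {q : ℂ} (hq : ‖q‖ < 1) : eulerProd q ≠ 0 :=
  qPoch_ne_zero_of_norm_lt_one hq hq

lemma tendsto_prod_range_qPoch (a : ℂ) {q : ℂ} (hq : ‖q‖ < 1) :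
    Tendsto (fun N => ∏ n ∈ Finset.range N, (1 - a * q ^ n)) atTop (𝓝 (qPoch a q)) :=
  (multipliable_qPoch a hq).tendsto_prod_tprod_nat

lemma continuous_qPoch {q : ℂ} (hq : ‖q‖ < 1) : Continuous fun a => qPoch a q := by
  rw [continuous_iff_continuousAt]
  intro a
  have := tendsto_tprod_one_add_of_dominated_convergence (𝓕 := 𝓝 a)
    (f := fun (b : ℂ) (n : ℕ) => -(b * q ^ n)) (g := fun n => -(a * q ^ n))
    (bound := fun n => (‖a‖ + 1) * ‖q‖ ^ n)
    ((summable_geometric_of_lt_one (norm_nonneg q) hq).mul_left _)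
    (fun k => (Continuous.tendsto (by fun_prop) a)) ?_
  · simpa [ContinuousAt, qPoch, sub_eq_add_neg] using this
  · have h : ∀ᶠ b in 𝓝 a, ‖b‖ < ‖a‖ + 1 :=
      continuous_norm.continuousAt.eventually_lt continuousAt_const (by simp)
    filter_upwards [h] with b hb k
    rw [norm_neg, norm_mul, norm_pow]
    gcongr

lemma qPoch_eq_one_sub_mul (a : ℂ) {q : ℂ} (hq : ‖q‖ < 1) :
    qPoch a q = (1 - a) * qPoch (a * q) q := by
  rw [qPoch, tprod_eq_zero_mul']
  · simp [qPoch, pow_succ', mul_assoc]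
  · simpa [pow_succ', mul_assoc] using multipliable_qPoch (a * q) hq

lemma norm_pow_lt_one {q : ℂ} (hq : ‖q‖ < 1) {k : ℕ} (hk : k ≠ 0) : ‖q ^ k‖ < 1 := by
  rw [norm_pow]
  exact pow_lt_one₀ (norm_nonneg q) hq hk

lemma qPoch_split_two (a : ℂ) {q : ℂ} (hq : ‖q‖ < 1) :
    qPoch a q = qPoch a (q ^ 2) * qPoch (a * q) (q ^ 2) := by
  have h2 : ‖q ^ 2‖ < 1 := norm_pow_lt_one hq two_ne_zero
  refine tendsto_nhds_unique (((tendsto_prod_range_qPoch a hq).comp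
    (tendsto_id.const_mul_atTop' two_pos))) ?_
  refine ((tendsto_prod_range_qPoch a h2).mul (tendsto_prod_range_qPoch (a * q) h2)).congr
    fun N => ?_
  simp only [Function.comp_apply, id]
  induction N with
  | zero => simp
  | succ N ih =>
    rw [Finset.prod_range_succ, Finset.prod_range_succ, show 2 * (N + 1) = 2 * N + 1 + 1 by ring,
      Finset.prod_range_succ, Finset.prod_range_succ, ← ih]
    ring

lemma qPoch_split_three (a : ℂ) {q : ℂ} (hq : ‖q‖ < 1) :
    qPoch a q = qPoch a (q ^ 3) * qPoch (a * q) (q ^ 3) * qPoch (a * q ^ 2) (q ^ 3) := by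
  have h3 : ‖q ^ 3‖ < 1 := norm_pow_lt_one hq three_ne_zero
  refine tendsto_nhds_unique (((tendsto_prod_range_qPoch a hq).comp
    (tendsto_id.const_mul_atTop' three_pos))) ?_
  refine (((tendsto_prod_range_qPoch a h3).mul (tendsto_prod_range_qPoch (a * q) h3)).mul
    (tendsto_prod_range_qPoch (a * q ^ 2) h3)).congr fun N => ?_
  simp only [Function.comp_apply, id]
  induction N with
  | zero => simp
  | succ N ih =>
    rw [Finset.prod_range_succ, Finset.prod_range_succ, Finset.prod_range_succ,
      show 3 * (N + 1) = 3 * N + 1 + 1 + 1 by ring,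
      Finset.prod_range_succ, Finset.prod_range_succ, Finset.prod_range_succ, ← ih]
    ring

lemma qPoch_mul_qPoch_neg (a : ℂ) {q : ℂ} (hq : ‖q‖ < 1) :
    qPoch a q * qPoch (-a) q = qPoch (a ^ 2) (q ^ 2) := by
  rw [qPoch, qPoch, ← (multipliable_qPoch a hq).tprod_mul (multipliable_qPoch (-a) hq), qPoch]
  refine tprod_congr fun n => ?_
  ring

lemma qPoch_mul_cube_root (a : ℂ) {q w : ℂ} (hq : ‖q‖ < 1) (hw : w ^ 2 + w + 1 = 0) :
    qPoch a q * qPoch (w * a) q * qPoch (w ^ 2 * a) q = qPoch (a ^ 3) (q ^ 3) := by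
  rw [qPoch, qPoch, ← (multipliable_qPoch a hq).tprod_mul (multipliable_qPoch (w * a) hq), qPoch,
    ← ((multipliable_qPoch a hq).mul (multipliable_qPoch (w * a) hq)).tprod_mul
      (multipliable_qPoch (w ^ 2 * a) hq), qPoch]
  refine tprod_congr fun n => ?_
  have h3 : w ^ 3 = 1 := by linear_combination (w - 1) * hw
  have hx : (a ^ 3 * (q ^ 3) ^ n) = (a * q ^ n) ^ 3 := by ring
  rw [hx]
  generalize hy : a * q ^ n = y
  rw [mul_assoc w, mul_assoc (w ^ 2), hy]
  linear_combination (-y + w * y ^ 2) * hw - y ^ 3 * h3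

/-- The terms of the bilateral theta series. -/
def thetaTerm (q z : ℂ) (n : ℤ) : ℂ := (-1) ^ n * q ^ (n * (n - 1) / 2) * z ^ n

/-- The bilateral theta series `∑ (-1)^n q^{n(n-1)/2} z^n`. -/
def theta (q z : ℂ) : ℂ := ∑' n : ℤ, thetaTerm q z n

lemma two_mul_triangle (n : ℤ) : 2 * (n * (n - 1) / 2) = n * (n - 1) :=
  Int.mul_ediv_cancel' (Int.even_mul_pred_self n).two_dvd

lemma summable_pow_triangle {r : ℝ} (hr0 : 0 < r) (hr : r < 1) {c : ℝ} (hc : 0 < c) :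
    Summable fun n : ℕ => r ^ ((n : ℤ) * (n - 1) / 2) * c ^ n := by
  refine summable_of_ratio_test_tendsto_lt_one zero_lt_one
    (Eventually.of_forall fun n => (by positivity)) ?_
  have h : Tendsto (fun n : ℕ => r ^ n * c) atTop (𝓝 0) := by
    simpa using (tendsto_pow_atTop_nhds_zero_of_lt_one hr0.le hr).mul_const c
  refine h.congr fun n => ?_
  have he : (((n + 1 : ℕ) : ℤ) * (((n + 1 : ℕ) : ℤ) - 1) / 2) = (n : ℤ) * (n - 1) / 2 + n := by
    have h1 := two_mul_triangle n
    have h2 := two_mul_triangle ((n + 1 : ℕ) : ℤ)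
    push_cast at h2 ⊢
    linarith
  rw [he, zpow_add₀ hr0.ne', pow_succ, Real.norm_of_nonneg (by positivity),
    Real.norm_of_nonneg (by positivity), zpow_natCast]
  have : r ^ ((n : ℤ) * (n - 1) / 2) ≠ 0 := (zpow_pos hr0 _).ne'
  field_simp

lemma summable_norm_thetaTerm {q z : ℂ} (hq0 : q ≠ 0) (hq : ‖q‖ < 1) (hz : z ≠ 0) :
    Summable fun n => ‖thetaTerm q z n‖ := by
  have hr : 0 < ‖q‖ := norm_pos_iff.mpr hq0
  have hc : 0 < ‖z‖ := norm_pos_iff.mpr hz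
  simp only [thetaTerm, norm_mul, norm_zpow, norm_neg, norm_one, one_zpow, one_mul]
  refine Summable.of_nat_of_neg ?_ ?_
  · simpa using summable_pow_triangle hr hq hc
  · refine (summable_pow_triangle hr hq (div_pos hr hc)).congr fun n => ?_
    have he : (-(n : ℤ)) * (-(n : ℤ) - 1) / 2 = (n : ℤ) * (n - 1) / 2 + n := by
      have h1 := two_mul_triangle n
      have h2 := two_mul_triangle (-(n : ℤ))
      linarith
    rw [he, zpow_add₀ hr.ne', zpow_neg, zpow_natCast, zpow_natCast, div_pow]
    ring

lemma summable_thetaTerm {q z : ℂ} (hq0 : q ≠ 0) (hq : ‖q‖ < 1) (hz : z ≠ 0) :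
    Summable (thetaTerm q z) :=
  (summable_norm_thetaTerm hq0 hq hz).of_norm

lemma theta_inv {q z : ℂ} (hz : z ≠ 0) : theta q z⁻¹ = -(theta q z / z) := by
  rw [theta, theta, ← tsum_div_const, ← tsum_neg, ← (Equiv.subLeft (1 : ℤ)).tsum_eq]
  refine tsum_congr fun n => ?_
  simp only [thetaTerm, Equiv.subLeft_apply]
  rw [show (1 - n) * (1 - n - 1) = n * (n - 1) by ring, inv_zpow', show -(1 - n) = n - 1 by ring,
    zpow_sub₀ hz, zpow_sub₀ (by norm_num : (-1 : ℂ) ≠ 0), zpow_one, zpow_one]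
  rcases Int.even_or_odd n with h | h <;> simp [h.neg_one_zpow] <;> ring

lemma theta_mul_base {q z : ℂ} (hq0 : q ≠ 0) (hz : z ≠ 0) : theta q (q * z) = -(theta q z / z) := by
  rw [theta, theta, ← tsum_div_const, ← tsum_neg, ← (Equiv.subRight (1 : ℤ)).tsum_eq]
  refine tsum_congr fun n => ?_
  simp only [thetaTerm, Equiv.subRight_apply]
  have he : n * (n - 1) / 2 = (n - 1) * (n - 1 - 1) / 2 + (n - 1) := by
    have h1 := two_mul_triangle n
    have h2 := two_mul_triangle (n - 1)
    linarith
  rw [he, mul_zpow, zpow_add₀ hq0, zpow_sub₀ hz, zpow_sub₀ (by norm_num : (-1 : ℂ) ≠ 0), zpow_one,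
    zpow_one]
  ring

lemma theta_base_div {q z : ℂ} (hq0 : q ≠ 0) (hz : z ≠ 0) : theta q (q / z) = theta q z := by
  rw [div_eq_mul_inv, theta_mul_base hq0 (inv_ne_zero hz), theta_inv hz]
  field_simp

/-- Pairs of integers, split according to whether the two coordinates have the same parity. -/
def sumDiffEquiv : (ℤ × ℤ) ⊕ (ℤ × ℤ) ≃ ℤ × ℤ where
  toFun := Sum.elim (fun p => (p.1 + p.2, p.1 - p.2)) (fun p => (p.1 + p.2 + 1, p.1 - p.2))
  invFun p := if (p.1 + p.2) % 2 = 0 then .inl ((p.1 + p.2) / 2, (p.1 - p.2) / 2)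
    else .inr ((p.1 + p.2 - 1) / 2, (p.1 - p.2 - 1) / 2)
  left_inv := by
    rintro (⟨k, l⟩ | ⟨k, l⟩)
    · have h : (k + l + (k - l)) % 2 = 0 := by omega
      simp only [Sum.elim_inl, h, if_true, Sum.inl.injEq, Prod.mk.injEq]
      omega
    · have h : ¬ (k + l + 1 + (k - l)) % 2 = 0 := by omega
      simp only [Sum.elim_inr, h, if_false, Sum.inr.injEq, Prod.mk.injEq]
      omega
  right_inv := by
    rintro ⟨m, n⟩
    dsimp only
    split_ifs with h
    · simp only [Sum.elim_inl, Prod.mk.injEq]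
      omega
    · simp only [Sum.elim_inr, Prod.mk.injEq]
      omega

lemma thetaTerm_sq_neg (q w : ℂ) (n : ℤ) :
    thetaTerm (q ^ 2) (-w) n = q ^ (n * (n - 1)) * w ^ n := by
  rw [thetaTerm, ← zpow_natCast, ← zpow_mul, Nat.cast_ofNat, two_mul_triangle,
    ← neg_one_mul w, mul_zpow]
  rcases Int.even_or_odd n with h | h <;> simp [h.neg_one_zpow]

/-- The product `θ(xy) θ(x/y)`, as an alternating form of rank two in `x` and `y`. -/
lemma theta_mul_theta {q x y : ℂ} (hq0 : q ≠ 0) (hq : ‖q‖ < 1) (hx : x ≠ 0) (hy : y ≠ 0) :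
    theta q (x * y) * theta q (x / y) =
      theta (q ^ 2) (-x ^ 2) * theta (q ^ 2) (-(q * y ^ 2)) -
        x / y * theta (q ^ 2) (-(q * x ^ 2)) * theta (q ^ 2) (-y ^ 2) := by
  have hq20 : q ^ 2 ≠ 0 := pow_ne_zero 2 hq0
  have hq2 : ‖q ^ 2‖ < 1 := norm_pow_lt_one hq two_ne_zero
  have hx2 : -x ^ 2 ≠ 0 := neg_ne_zero.mpr (pow_ne_zero 2 hx)
  have hy2 : -y ^ 2 ≠ 0 := neg_ne_zero.mpr (pow_ne_zero 2 hy)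
  have hqx : -(q * x ^ 2) ≠ 0 := neg_ne_zero.mpr (mul_ne_zero hq0 (pow_ne_zero 2 hx))
  have hqy : -(q * y ^ 2) ≠ 0 := neg_ne_zero.mpr (mul_ne_zero hq0 (pow_ne_zero 2 hy))
  have hm1 : (-1 : ℂ) ≠ 0 := by norm_num
  have hyx : theta (q ^ 2) (-y ^ 2) = y ^ 2 * theta (q ^ 2) (q ^ 2 * -y ^ 2) := by
    rw [theta_mul_base hq20 hy2]
    field_simp
  have hy2' : q ^ 2 * -y ^ 2 ≠ 0 := mul_ne_zero hq20 hy2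
  rw [hyx]
  simp only [theta]
  rw [tsum_mul_tsum_of_summable_norm
      (summable_norm_thetaTerm hq0 hq (mul_ne_zero hx hy))
      (summable_norm_thetaTerm hq0 hq (div_ne_zero hx hy)),
    tsum_mul_tsum_of_summable_norm (summable_norm_thetaTerm hq20 hq2 hx2)
      (summable_norm_thetaTerm hq20 hq2 hqy), ← sumDiffEquiv.tsum_eq]
  have hS := summable_mul_of_summable_norm
    (summable_norm_thetaTerm hq20 hq2 hx2) (summable_norm_thetaTerm hq20 hq2 hqy)
  have hT := summable_mul_of_summable_norm
    (summable_norm_thetaTerm hq20 hq2 hqx) (summable_norm_thetaTerm hq20 hq2 hy2')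
  have hodd : x / y * (∑' n, thetaTerm (q ^ 2) (-(q * x ^ 2)) n) *
      (y ^ 2 * ∑' n, thetaTerm (q ^ 2) (q ^ 2 * -y ^ 2) n) =
      ∑' p : ℤ × ℤ, x * y *
        (thetaTerm (q ^ 2) (-(q * x ^ 2)) p.1 * thetaTerm (q ^ 2) (q ^ 2 * -y ^ 2) p.2) := by
    rw [tsum_mul_left, ← tsum_mul_tsum_of_summable_norm (summable_norm_thetaTerm hq20 hq2 hqx)
      (summable_norm_thetaTerm hq20 hq2 hy2')]
    field_simp
  rw [hodd, sub_eq_add_neg, ← tsum_neg]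
  have e1 (p : ℤ × ℤ) : thetaTerm q (x * y) (sumDiffEquiv (.inl p)).1 *
      thetaTerm q (x / y) (sumDiffEquiv (.inl p)).2 =
      thetaTerm (q ^ 2) (-x ^ 2) p.1 * thetaTerm (q ^ 2) (-(q * y ^ 2)) p.2 := by
    obtain ⟨k, l⟩ := p
    rw [thetaTerm_sq_neg, thetaTerm_sq_neg]
    simp only [sumDiffEquiv, Equiv.coe_fn_mk, Sum.elim_inl, thetaTerm]
    have hs : (-1 : ℂ) ^ (k + l) * (-1) ^ (k - l) = 1 := by
      rw [← zpow_add₀ hm1, show k + l + (k - l) = 2 * k by ring, zpow_mul]; simp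
    have he : (k + l) * (k + l - 1) / 2 + (k - l) * (k - l - 1) / 2 =
        k * (k - 1) + (l * (l - 1) + l) := by
      have h1 := two_mul_triangle (k + l)
      have h2 := two_mul_triangle (k - l)
      linarith
    have hqe := congrArg (q ^ ·) he
    simp only [zpow_add₀ hq0] at hqe
    have hxe : x ^ (k + l) * x ^ (k - l) = (x ^ 2) ^ k := by
      rw [← zpow_add₀ hx, ← zpow_natCast, ← zpow_mul]; congr 1; push_cast; ring
    have hye : y ^ (k + l) / y ^ (k - l) = (y ^ 2) ^ l := by
      rw [← zpow_sub₀ hy, ← zpow_natCast, ← zpow_mul]; congr 1; push_cast; ring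
    rw [mul_zpow, mul_zpow, div_zpow, ← hxe, ← hye]
    calc _ = ((-1 : ℂ) ^ (k + l) * (-1) ^ (k - l)) *
          (q ^ ((k + l) * (k + l - 1) / 2) * q ^ ((k - l) * (k - l - 1) / 2)) *
          (x ^ (k + l) * x ^ (k - l)) * (y ^ (k + l) / y ^ (k - l)) := by ring
      _ = _ := by rw [hs, hqe]; ring
  have e2 (p : ℤ × ℤ) : thetaTerm q (x * y) (sumDiffEquiv (.inr p)).1 *
      thetaTerm q (x / y) (sumDiffEquiv (.inr p)).2 =
      -(x * y *
        (thetaTerm (q ^ 2) (-(q * x ^ 2)) p.1 * thetaTerm (q ^ 2) (q ^ 2 * -y ^ 2) p.2)) := by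
    obtain ⟨k, l⟩ := p
    rw [thetaTerm_sq_neg, mul_neg, thetaTerm_sq_neg]
    simp only [sumDiffEquiv, Equiv.coe_fn_mk, Sum.elim_inr, thetaTerm]
    have hs : (-1 : ℂ) ^ (k + l + 1) * (-1) ^ (k - l) = -1 := by
      rw [← zpow_add₀ hm1, show k + l + 1 + (k - l) = 2 * k + 1 by ring, zpow_add₀ hm1, zpow_mul]
      simp
    have he : (k + l + 1) * (k + l + 1 - 1) / 2 + (k - l) * (k - l - 1) / 2 =
        (k * (k - 1) + k) + (l * (l - 1) + l + l) := by
      have h1 := two_mul_triangle (k + l + 1)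
      have h2 := two_mul_triangle (k - l)
      linarith
    have hxe : x ^ (k + l + 1) * x ^ (k - l) = x * (x ^ 2) ^ k := by
      rw [← zpow_add₀ hx, ← zpow_natCast, ← zpow_mul, ← zpow_one_add₀ hx]
      congr 1; push_cast; ring
    have hye : y ^ (k + l + 1) / y ^ (k - l) = y * (y ^ 2) ^ l := by
      rw [← zpow_sub₀ hy, ← zpow_natCast, ← zpow_mul, ← zpow_one_add₀ hy]
      congr 1; push_cast; ring
    rw [mul_zpow, mul_zpow, div_zpow, mul_zpow]
    calc _ = ((-1 : ℂ) ^ (k + l + 1) * (-1) ^ (k - l)) *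
          (q ^ ((k + l + 1) * (k + l + 1 - 1) / 2) * q ^ ((k - l) * (k - l - 1) / 2)) *
          (x ^ (k + l + 1) * x ^ (k - l)) * (y ^ (k + l + 1) / y ^ (k - l)) := by ring
      _ = _ := by
        rw [hs, hxe, hye, zpow_add₀ hq0 ((k + l + 1) * (k + l + 1 - 1) / 2) _ |>.symm, he]
        simp only [zpow_add₀ hq0, mul_zpow, pow_two, mul_zpow]
        ring
  rw [Summable.tsum_sum]
  · rw [tsum_congr e1, tsum_congr e2]
  · exact hS.congr fun p => (e1 p).symm
  · exact ((hT.mul_left (x * y)).neg).congr fun p => (e2 p).symm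

/-- The three-term relation for theta functions. -/
lemma theta_three_term {q a b c d : ℂ} (hq0 : q ≠ 0) (hq : ‖q‖ < 1) (ha : a ≠ 0) (hb : b ≠ 0)
    (hc : c ≠ 0) (hd : d ≠ 0) :
    theta q (a * b) * theta q (a / b) / a * (theta q (c * d) * theta q (c / d) / c) -
      theta q (a * c) * theta q (a / c) / a * (theta q (b * d) * theta q (b / d) / b) +
      theta q (a * d) * theta q (a / d) / a * (theta q (b * c) * theta q (b / c) / b) = 0 := by
  rw [theta_mul_theta hq0 hq ha hb, theta_mul_theta hq0 hq ha hc, theta_mul_theta hq0 hq ha hd,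
    theta_mul_theta hq0 hq hb hc, theta_mul_theta hq0 hq hb hd, theta_mul_theta hq0 hq hc hd]
  field_simp
  ring

/-- The Gaussian binomial coefficients. -/
def gaussBinom (q : ℂ) : ℕ → ℕ → ℂ
  | _, 0 => 1
  | 0, _ + 1 => 0
  | n + 1, k + 1 => gaussBinom q n k + q ^ (k + 1) * gaussBinom q n (k + 1)

/-- The finite product `(q; q)_m`. -/
def eulerFinite (q : ℂ) (m : ℕ) : ℂ := ∏ k ∈ Finset.range m, (1 - q ^ (k + 1))

lemma eulerFinite_succ (q : ℂ) (m : ℕ) :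
    eulerFinite q (m + 1) = eulerFinite q m * (1 - q ^ (m + 1)) :=
  Finset.prod_range_succ _ _

lemma gaussBinom_zero_right (q : ℂ) (n : ℕ) : gaussBinom q n 0 = 1 := by
  cases n <;> rfl

lemma gaussBinom_eq_zero (q : ℂ) : ∀ {n k : ℕ}, n < k → gaussBinom q n k = 0
  | 0, _ + 1, _ => rfl
  | n + 1, k + 1, h => by
    rw [gaussBinom, gaussBinom_eq_zero q (by omega : n < k),
      gaussBinom_eq_zero q (by omega : n < k + 1)]
    simp

lemma gaussBinom_mul_eulerFinite (q : ℂ) {n k : ℕ} (h : k ≤ n) :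
    gaussBinom q n k * (eulerFinite q k * eulerFinite q (n - k)) = eulerFinite q n := by
  induction n generalizing k with
  | zero =>
    obtain rfl : k = 0 := by omega
    simp [gaussBinom, eulerFinite]
  | succ n ih =>
    cases k with
    | zero => simp [gaussBinom, eulerFinite]
    | succ k =>
      rw [gaussBinom, Nat.add_sub_add_right, eulerFinite_succ q n]
      have h1 := ih (by omega : k ≤ n)
      rcases (by omega : k = n ∨ k + 1 ≤ n) with rfl | hk
      · rw [gaussBinom_eq_zero q (Nat.lt_succ_self k), eulerFinite_succ]
        linear_combination (1 - q ^ (k + 1)) * h1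
      · obtain ⟨m, rfl⟩ := Nat.exists_eq_add_of_le hk
        have h2 := ih hk
        rw [show k + 1 + m - (k + 1) = m by omega] at h2
        rw [show k + 1 + m - k = m + 1 by omega] at h1 ⊢
        rw [eulerFinite_succ] at h1 h2 ⊢
        rw [eulerFinite_succ]
        linear_combination (1 - q ^ (k + 1)) * h1 + q ^ (k + 1) * (1 - q ^ (m + 1)) * h2

/-- The finite `q`-binomial theorem. -/
lemma prod_one_sub_eq_sum_gaussBinom (q z : ℂ) (M : ℕ) :
    ∏ k ∈ Finset.range M, (1 - z * q ^ k) =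
      ∑ j ∈ Finset.range (M + 1), gaussBinom q M j * ((-1) ^ j * q ^ (j.choose 2) * z ^ j) := by
  induction M generalizing z with
  | zero => simp [gaussBinom]
  | succ M ih =>
    have h := ih (z * q)
    rw [Finset.prod_range_succ']
    have hp : ∏ k ∈ Finset.range M, (1 - z * q ^ (k + 1)) =
        ∏ k ∈ Finset.range M, (1 - z * q * q ^ k) :=
      Finset.prod_congr rfl fun k _ => by ring
    rw [hp, h, Finset.sum_range_succ' _ (M + 1), mul_sub, pow_zero, mul_one, mul_one]
    have hsplit : ∑ j ∈ Finset.range (M + 1), gaussBinom q (M + 1) (j + 1) *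
          ((-1) ^ (j + 1) * q ^ ((j + 1).choose 2) * z ^ (j + 1)) =
        -(∑ j ∈ Finset.range (M + 1),
          gaussBinom q M j * ((-1) ^ j * q ^ (j.choose 2) * (z * q) ^ j)) * z +
        ∑ j ∈ Finset.range (M + 1), gaussBinom q M (j + 1) *
          ((-1) ^ (j + 1) * q ^ ((j + 1).choose 2) * (z * q) ^ (j + 1)) := by
      rw [← Finset.sum_neg_distrib, Finset.sum_mul, ← Finset.sum_add_distrib]
      refine Finset.sum_congr rfl fun j _ => ?_
      rw [gaussBinom, Nat.choose_succ_succ' j 1, Nat.choose_one_right]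
      ring
    rw [hsplit, Finset.sum_range_succ (fun j => gaussBinom q M (j + 1) * _),
      gaussBinom_eq_zero q (Nat.lt_succ_self M), zero_mul, add_zero]
    rw [Finset.sum_range_succ' _ M]
    simp [gaussBinom_zero_right]
    ring

lemma prod_one_sub_reflect {q z : ℂ} (hq : q ≠ 0) (hz : z ≠ 0) (N : ℕ) :
    ∏ k ∈ Finset.range N, (1 - z / q ^ N * q ^ k) =
      (-z) ^ N / q ^ ((N + 1).choose 2) * ∏ k ∈ Finset.range N, (1 - q / z * q ^ k) := by
  induction N with
  | zero => simp
  | succ N ih =>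
    rw [Finset.prod_range_succ', Finset.prod_range_succ _ N]
    have hp : ∏ k ∈ Finset.range N, (1 - z / q ^ (N + 1) * q ^ (k + 1)) =
        ∏ k ∈ Finset.range N, (1 - z / q ^ N * q ^ k) :=
      Finset.prod_congr rfl fun k _ => by rw [pow_succ q N, pow_succ q k]; field_simp
    rw [hp, ih, Nat.choose_succ_succ' (N + 1) 1, Nat.choose_one_right, pow_add]
    field_simp
    ring

lemma natCast_choose_two (j : ℕ) : ((j.choose 2 : ℕ) : ℤ) = (j : ℤ) * (j - 1) / 2 := by
  have h1 := two_mul_triangle j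
  have h2 : 2 * ((j.choose 2 : ℕ) : ℤ) = j * (j - 1) := by
    induction j with
    | zero => simp
    | succ j ih =>
      rw [Nat.choose_succ_succ' j 1, Nat.choose_one_right]
      push_cast
      have := ih (two_mul_triangle j)
      linarith
  omega

/-- The finite form of the Jacobi triple product. -/
lemma finite_triple_product {q z : ℂ} (hq : q ≠ 0) (hz : z ≠ 0) (N : ℕ) :
    (∏ k ∈ Finset.range N, (1 - z * q ^ k)) * ∏ k ∈ Finset.range N, (1 - q / z * q ^ k) =
      ∑ j ∈ Finset.range (2 * N + 1), gaussBinom q (2 * N) j * thetaTerm q z (j - N) := by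
  have h := prod_one_sub_eq_sum_gaussBinom q (z / q ^ N) (2 * N)
  rw [two_mul, Finset.prod_range_add, prod_one_sub_reflect hq hz, ← two_mul] at h
  have hp : ∏ k ∈ Finset.range N, (1 - z / q ^ N * q ^ (N + k)) =
      ∏ k ∈ Finset.range N, (1 - z * q ^ k) :=
    Finset.prod_congr rfl fun k _ => by rw [pow_add]; field_simp
  rw [hp] at h
  have hc : (-z) ^ N / q ^ ((N + 1).choose 2) ≠ 0 :=
    div_ne_zero (pow_ne_zero _ (neg_ne_zero.mpr hz)) (pow_ne_zero _ hq)
  apply mul_left_cancel₀ hc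
  rw [Finset.mul_sum]
  rw [mul_comm (∏ k ∈ Finset.range N, (1 - z * q ^ k)), ← mul_assoc, h]
  refine Finset.sum_congr rfl fun j _ => ?_
  have hm1 : (-1 : ℂ) ≠ 0 := by norm_num
  have he : ((j.choose 2 : ℕ) : ℤ) + (((N + 1).choose 2 : ℕ) : ℤ) =
      ((j : ℤ) - N) * ((j : ℤ) - N - 1) / 2 + N * j := by
    rw [natCast_choose_two, natCast_choose_two]
    have h1 := two_mul_triangle j
    have h2 := two_mul_triangle ((N + 1 : ℕ) : ℤ)
    have h3 := two_mul_triangle ((j : ℤ) - N)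
    push_cast at h2 ⊢
    linarith
  have hqe : q ^ (j.choose 2) * q ^ ((N + 1).choose 2) =
      q ^ (((j : ℤ) - N) * ((j : ℤ) - N - 1) / 2) * (q ^ N) ^ j := by
    rw [← zpow_natCast, ← zpow_natCast q ((N + 1).choose 2), ← zpow_add₀ hq, he, zpow_add₀ hq,
      ← pow_mul]
    norm_cast
  rw [thetaTerm, zpow_sub₀ hm1, zpow_sub₀ hz, neg_pow z, div_pow, zpow_natCast, zpow_natCast,
    zpow_natCast, zpow_natCast]
  field_simp
  linear_combination gaussBinom q (2 * N) j * hqe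

lemma eulerFinite_ne_zero {q : ℂ} (hq : ‖q‖ < 1) (m : ℕ) : eulerFinite q m ≠ 0 :=
  Finset.prod_ne_zero_iff.mpr fun _ _ =>
    one_sub_ne_zero_of_norm_lt_one (norm_pow_lt_one hq (Nat.succ_ne_zero _))

lemma tendsto_eulerFinite {q : ℂ} (hq : ‖q‖ < 1) :
    Tendsto (eulerFinite q) atTop (𝓝 (eulerProd q)) :=
  (tendsto_prod_range_qPoch q hq).congr fun m =>
    Finset.prod_congr rfl fun k _ => by rw [pow_succ']

lemma gaussBinom_eq_div {q : ℂ} (hq : ‖q‖ < 1) {n k : ℕ} (h : k ≤ n) :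
    gaussBinom q n k = eulerFinite q n * ((eulerFinite q k)⁻¹ * (eulerFinite q (n - k))⁻¹) := by
  rw [← gaussBinom_mul_eulerFinite q h]
  have h1 := eulerFinite_ne_zero hq k
  have h2 := eulerFinite_ne_zero hq (n - k)
  field_simp

lemma exists_norm_gaussBinom_le {q : ℂ} (hq : ‖q‖ < 1) :
    ∃ C : ℝ, 0 ≤ C ∧ ∀ n k, ‖gaussBinom q n k‖ ≤ C := by
  obtain ⟨a, ha⟩ := (tendsto_eulerFinite hq).norm.bddAbove_range
  obtain ⟨b, hb⟩ := ((tendsto_eulerFinite hq).inv₀ (eulerProd_ne_zero hq)).norm.bddAbove_range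
  rw [mem_upperBounds, Set.forall_mem_range] at ha hb
  have ha0 : 0 ≤ a := (norm_nonneg _).trans (ha 0)
  have hb0 : 0 ≤ b := (norm_nonneg _).trans (hb 0)
  refine ⟨a * (b * b), by positivity, fun n k => ?_⟩
  rcases le_or_gt k n with h | h
  · rw [gaussBinom_eq_div hq h, norm_mul, norm_mul]
    gcongr
    exacts [ha n, hb k, hb (n - k)]
  · rw [gaussBinom_eq_zero q h, norm_zero]
    positivity

/-- The Jacobi triple product. -/
lemma theta_eq {q z : ℂ} (hq0 : q ≠ 0) (hq : ‖q‖ < 1) (hz : z ≠ 0) :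
    theta q z = qPoch z q * qPoch (q / z) q * eulerProd q := by
  obtain ⟨C, hC0, hC⟩ := exists_norm_gaussBinom_le hq
  have hE := eulerProd_ne_zero hq
  let c : ℕ → ℤ → ℂ := fun N n => if -(N : ℤ) ≤ n then gaussBinom q (2 * N) (n + N).toNat else 0
  have hc (n : ℤ) : Tendsto (fun N => c N n) atTop (𝓝 (eulerProd q)⁻¹) := by
    have h1 : Tendsto (fun N : ℕ => 2 * N) atTop atTop := tendsto_id.const_mul_atTop' two_pos
    have h2 : Tendsto (fun N : ℕ => (n + N).toNat) atTop atTop :=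
      tendsto_atTop.mpr fun b => (eventually_ge_atTop (b + n.natAbs)).mono fun N hN => by omega
    have h3 : Tendsto (fun N : ℕ => 2 * N - (n + N).toNat) atTop atTop :=
      tendsto_atTop.mpr fun b => (eventually_ge_atTop (b + n.natAbs)).mono fun N hN => by omega
    have hI := (tendsto_eulerFinite hq).inv₀ hE
    have := ((tendsto_eulerFinite hq).comp h1).mul ((hI.comp h2).mul (hI.comp h3))
    rw [← mul_assoc, mul_inv_cancel₀ hE, one_mul] at this
    refine this.congr' ((eventually_ge_atTop n.natAbs).mono fun N hN => ?_)
    simp only [c, Function.comp_apply]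
    rw [if_pos (by omega), gaussBinom_eq_div hq (by omega)]
  have hlim : Tendsto (fun N => ∑' n, c N n * thetaTerm q z n) atTop
      (𝓝 (∑' n, (eulerProd q)⁻¹ * thetaTerm q z n)) := by
    refine tendsto_tsum_of_dominated_convergence ((summable_norm_thetaTerm hq0 hq hz).mul_left C)
      (fun n => (hc n).mul_const _) (Eventually.of_forall fun N n => ?_)
    rw [norm_mul]
    gcongr
    simp only [c]
    split_ifs
    · exact hC _ _
    · simpa using hC0
  have hfin (N : ℕ) : ∑' n, c N n * thetaTerm q z n =
      (∏ k ∈ Finset.range N, (1 - z * q ^ k)) * ∏ k ∈ Finset.range N, (1 - q / z * q ^ k) := by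
    rw [finite_triple_product hq0 hz,
      tsum_eq_sum (s := (Finset.range (2 * N + 1)).image fun j : ℕ => (j : ℤ) - N),
      Finset.sum_image (fun i _ j _ h => by simpa using h)]
    · refine Finset.sum_congr rfl fun j _ => ?_
      simp [c]
    · intro n hn
      have hn' : ¬ (-(N : ℤ) ≤ n ∧ n ≤ N) := by
        rintro ⟨h1, h2⟩
        refine hn (Finset.mem_image.mpr ⟨(n + N).toNat, Finset.mem_range.mpr (by omega), by omega⟩)
      simp only [c]
      split_ifs with h
      · rw [gaussBinom_eq_zero q (by omega), zero_mul]
      · rw [zero_mul]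
  rw [tsum_mul_left] at hlim
  have := tendsto_nhds_unique hlim (((tendsto_prod_range_qPoch z hq).mul
    (tendsto_prod_range_qPoch (q / z) hq)).congr fun N => (hfin N).symm)
  rw [← this, theta]
  field_simp
lemma thetaTerm_neg_one (q : ℂ) (n : ℤ) : thetaTerm q (-1) n = q ^ (n * (n - 1) / 2) := by
  rw [thetaTerm, mul_right_comm, ← mul_zpow, neg_one_mul, neg_neg, one_zpow, one_mul]

lemma thetaTerm_neg_one_add_one (q : ℂ) (n : ℕ) :
    thetaTerm q (-1) (n + 1) = q ^ (n * (n + 1) / 2) := by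
  rw [thetaTerm_neg_one, ← zpow_natCast]
  push_cast
  rw [add_sub_cancel_right, mul_comm]

lemma thetaTerm_neg_one_neg (q : ℂ) (n : ℕ) :
    thetaTerm q (-1) (-((n : ℤ) + 1) + 1) = q ^ (n * (n + 1) / 2) := by
  rw [← thetaTerm_neg_one_add_one, thetaTerm_neg_one, thetaTerm_neg_one,
    show (-((n : ℤ) + 1) + 1) * (-((n : ℤ) + 1) + 1 - 1) = ((n : ℤ) + 1) * ((n : ℤ) + 1 - 1) by
      ring]

lemma theta_neg_one_eq_tsum {q : ℂ} (hq0 : q ≠ 0) (hq : ‖q‖ < 1) :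
    theta q (-1) = 2 * ∑' n : ℕ, q ^ (n * (n + 1) / 2) := by
  have hs : Summable fun n : ℤ => thetaTerm q (-1) (n + 1) :=
    (summable_thetaTerm hq0 hq (neg_ne_zero.mpr one_ne_zero)).comp_injective (add_left_injective 1)
  have h1 : Summable fun n : ℕ => thetaTerm q (-1) (n + 1) :=
    hs.comp_injective (i := fun n : ℕ => (n : ℤ)) Nat.cast_injective
  have h2 : Summable fun n : ℕ => thetaTerm q (-1) (-((n : ℤ) + 1) + 1) :=
    hs.comp_injective (i := fun n : ℕ => -((n : ℤ) + 1)) fun a b h => by simpa using h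
  rw [theta, ← (Equiv.addRight (1 : ℤ)).tsum_eq]
  simp only [Equiv.coe_addRight]
  rw [tsum_of_nat_of_neg_add_one (f := fun n : ℤ => thetaTerm q (-1) (n + 1)) h1 h2, two_mul,
    tsum_congr (thetaTerm_neg_one_add_one q), tsum_congr (thetaTerm_neg_one_neg q)]

lemma eulerProd_sq_eq {q : ℂ} (hq : ‖q‖ < 1) :
    eulerProd q = qPoch q (q ^ 2) * eulerProd (q ^ 2) := by
  rw [eulerProd, qPoch_split_two q hq, ← pow_two]
  rfl

lemma qPoch_neg_self {q : ℂ} (hq : ‖q‖ < 1) :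
    qPoch (-q) q = eulerProd (q ^ 2) / eulerProd q := by
  rw [eq_div_iff (eulerProd_ne_zero hq), mul_comm]
  exact qPoch_mul_qPoch_neg q hq

lemma theta_neg_one {q : ℂ} (hq0 : q ≠ 0) (hq : ‖q‖ < 1) :
    theta q (-1) = 2 * (eulerProd (q ^ 2) ^ 2 / eulerProd q) := by
  rw [theta_eq hq0 hq (by norm_num), qPoch_eq_one_sub_mul _ hq, neg_one_mul, div_neg, div_one,
    qPoch_neg_self hq]
  have := eulerProd_ne_zero hq
  field_simp
  ring

lemma psi_eq {q : ℂ} (hq0 : q ≠ 0) (hq : ‖q‖ < 1) :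
    ∑' n : ℕ, q ^ (n * (n + 1) / 2) = eulerProd (q ^ 2) ^ 2 / eulerProd q := by
  have h := theta_neg_one_eq_tsum hq0 hq
  rw [theta_neg_one hq0 hq] at h
  exact (mul_left_cancel₀ two_ne_zero h).symm

lemma theta_sixth_self {q : ℂ} (hq0 : q ≠ 0) (hq : ‖q‖ < 1) :
    theta (q ^ 6) q =
      eulerProd q * eulerProd (q ^ 6) ^ 2 / (eulerProd (q ^ 2) * eulerProd (q ^ 3)) := by
  have h2 : ‖q ^ 2‖ < 1 := norm_pow_lt_one hq two_ne_zero
  have h3 : ‖q ^ 3‖ < 1 := norm_pow_lt_one hq three_ne_zero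
  have h6 : ‖q ^ 6‖ < 1 := norm_pow_lt_one hq (by norm_num)
  have e1 := eulerProd_sq_eq hq
  have e3 := eulerProd_sq_eq h3
  rw [← pow_mul, show 3 * 2 = 6 from rfl] at e3
  rw [qPoch_split_three q h2, ← pow_mul, show 2 * 3 = 6 from rfl, ← pow_succ',
    show q * (q ^ 2) ^ 2 = q ^ 5 by ring] at e1
  rw [theta_eq (pow_ne_zero 6 hq0) h6 hq0, show q ^ 6 / q = q ^ 5 by field_simp,
    eq_div_iff (mul_ne_zero (eulerProd_ne_zero h2) (eulerProd_ne_zero h3)), e1, e3]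
  ring

lemma theta_sixth_sq {q : ℂ} (hq0 : q ≠ 0) (hq : ‖q‖ < 1) :
    theta (q ^ 6) (q ^ 2) = eulerProd (q ^ 2) := by
  have h2 : ‖q ^ 2‖ < 1 := norm_pow_lt_one hq two_ne_zero
  have h6 : ‖q ^ 6‖ < 1 := norm_pow_lt_one hq (by norm_num)
  rw [theta_eq (pow_ne_zero 6 hq0) h6 (pow_ne_zero 2 hq0), eulerProd, eulerProd,
    qPoch_split_three _ h2, show q ^ 6 / q ^ 2 = q ^ 4 by field_simp]
  ring_nf

lemma theta_sixth_cube {q : ℂ} (hq0 : q ≠ 0) (hq : ‖q‖ < 1) :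
    theta (q ^ 6) (q ^ 3) = eulerProd (q ^ 3) ^ 2 / eulerProd (q ^ 6) := by
  have h3 : ‖q ^ 3‖ < 1 := norm_pow_lt_one hq three_ne_zero
  have h6 : ‖q ^ 6‖ < 1 := norm_pow_lt_one hq (by norm_num)
  have e3 := eulerProd_sq_eq h3
  rw [← pow_mul, show 3 * 2 = 6 from rfl] at e3
  rw [theta_eq (pow_ne_zero 6 hq0) h6 (pow_ne_zero 3 hq0), e3,
    show q ^ 6 / q ^ 3 = q ^ 3 by field_simp]
  have := eulerProd_ne_zero h6
  field_simp

lemma psi_pow_four_sub {q : ℂ} (hq0 : q ≠ 0) (hq : ‖q‖ < 1) :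
    (eulerProd (q ^ 2) ^ 2 / eulerProd q) ^ 4 -
        q * (eulerProd (q ^ 6) ^ 2 / eulerProd (q ^ 3)) ^ 4 =
      eulerProd (q ^ 2) ^ 3 * eulerProd (q ^ 3) ^ 5 / (eulerProd q ^ 3 * eulerProd (q ^ 6)) := by
  have n1 := eulerProd_ne_zero hq
  have n2 := eulerProd_ne_zero (norm_pow_lt_one hq two_ne_zero)
  have n3 := eulerProd_ne_zero (norm_pow_lt_one hq three_ne_zero)
  have n6 := eulerProd_ne_zero (norm_pow_lt_one hq (show 6 ≠ 0 by norm_num))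
  have h60 := pow_ne_zero 6 hq0
  have h20 := pow_ne_zero 2 hq0
  have h := theta_three_term h60 (norm_pow_lt_one hq (by norm_num)) (pow_ne_zero 3 hq0)
    one_ne_zero h20 hq0
  rw [show q ^ 3 * q ^ 2 = q ^ 6 / q by field_simp, show q ^ 3 * q = q ^ 6 / q ^ 2 by field_simp,
    theta_base_div h60 hq0, theta_base_div h60 h20, one_div, one_div, theta_inv hq0,
    theta_inv h20, show q ^ 2 / q = q by field_simp, show q ^ 3 / q ^ 2 = q by field_simp,
    show q ^ 3 / q = q ^ 2 by field_simp, ← pow_succ, mul_one, one_mul, one_mul, div_one,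
    theta_sixth_sq hq0 hq, theta_sixth_self hq0 hq, theta_sixth_cube hq0 hq] at h
  field_simp at h ⊢
  linear_combination -h

lemma theta_sixth_root {q z : ℂ} (hq0 : q ≠ 0) (hq : ‖q‖ < 1) (hz : z ^ 2 = z - 1) :
    theta q z = (1 - z) *
      (eulerProd q ^ 2 * eulerProd (q ^ 6) / (eulerProd (q ^ 2) * eulerProd (q ^ 3))) := by
  have hz0 : z ≠ 0 := by rintro rfl; norm_num at hz
  have h3 : ‖q ^ 3‖ < 1 := norm_pow_lt_one hq three_ne_zero
  have n1 := eulerProd_ne_zero hq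
  have n2 := eulerProd_ne_zero (norm_pow_lt_one hq two_ne_zero)
  have n3 := eulerProd_ne_zero h3
  have h := qPoch_mul_cube_root (w := -z) (-q) hq (by linear_combination hz)
  rw [show (-q) ^ 3 = -q ^ 3 by ring, qPoch_neg_self hq, qPoch_neg_self h3, ← pow_mul,
    show -z * -q = z * q by ring, show (-z) ^ 2 * -q = q / z by
      field_simp; linear_combination (-z - 1) * hz] at h
  rw [theta_eq hq0 hq hz0, qPoch_eq_one_sub_mul _ hq]
  field_simp at h ⊢
  linear_combination (1 - z) * h

lemma theta_cube_root {q w : ℂ} (hq0 : q ≠ 0) (hq : ‖q‖ < 1) (hw : w ^ 2 + w + 1 = 0) :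
    theta q w = (1 - w) * eulerProd (q ^ 3) := by
  have hw0 : w ≠ 0 := by rintro rfl; norm_num at hw
  have h := qPoch_mul_cube_root q hq hw
  rw [show w ^ 2 * q = q / w by field_simp; linear_combination (w - 1) * hw] at h
  rw [theta_eq hq0 hq hw0, qPoch_eq_one_sub_mul _ hq, eulerProd, eulerProd, ← h]
  ring

lemma psi_pow_four_sub_nine {q : ℂ} (hq0 : q ≠ 0) (hq : ‖q‖ < 1) :
    (eulerProd (q ^ 2) ^ 2 / eulerProd q) ^ 4 -
        9 * q * (eulerProd (q ^ 6) ^ 2 / eulerProd (q ^ 3)) ^ 4 =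
      eulerProd q ^ 5 * eulerProd (q ^ 6) ^ 3 / (eulerProd (q ^ 2) * eulerProd (q ^ 3) ^ 3) := by
  obtain ⟨s, hs⟩ := IsAlgClosed.exists_pow_nat_eq (-3 : ℂ) two_pos
  obtain ⟨z, hz⟩ : ∃ z : ℂ, z ^ 2 = z - 1 := ⟨(1 + s) / 2, by linear_combination hs / 4⟩
  have hz0 : z ≠ 0 := by rintro rfl; norm_num at hz
  have hz20 := pow_ne_zero 2 hz0
  have n1 := eulerProd_ne_zero hq
  have n2 := eulerProd_ne_zero (norm_pow_lt_one hq two_ne_zero)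
  have n3 := eulerProd_ne_zero (norm_pow_lt_one hq three_ne_zero)
  have n6 := eulerProd_ne_zero (norm_pow_lt_one hq (show 6 ≠ 0 by norm_num))
  have h := theta_three_term hq0 hq (neg_ne_zero.mpr one_ne_zero) one_ne_zero hz20 hz0
  have hz3 : z ^ 3 = -1 := by linear_combination (z + 1) * hz
  have hI := psi_pow_four_sub hq0 hq
  have key : 8 * (eulerProd (q ^ 2) ^ 2 / eulerProd q) ^ 3 *
      (eulerProd q ^ 2 * eulerProd (q ^ 6) / (eulerProd (q ^ 2) * eulerProd (q ^ 3))) +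
      (eulerProd q ^ 2 * eulerProd (q ^ 6) / (eulerProd (q ^ 2) * eulerProd (q ^ 3))) ^ 4 =
      9 * eulerProd (q ^ 3) ^ 4 := by
    rw [mul_one, div_one, ← pow_succ, hz3, show z ^ 2 / z = z by field_simp, one_mul, one_mul,
      show -1 * z ^ 2 = z⁻¹ by field_simp; linear_combination -hz3,
      show -1 / z ^ 2 = z by field_simp; linear_combination -hz3,
      show -1 * z = (z ^ 2)⁻¹ by field_simp; linear_combination -hz3,
      show -1 / z = z ^ 2 by field_simp; linear_combination -hz3, one_div, one_div,
      theta_inv hz0, theta_inv hz20, theta_neg_one hq0 hq, theta_sixth_root hq0 hq hz,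
      theta_cube_root hq0 hq (w := z ^ 2) (by linear_combination (z ^ 2 + z + 1) * hz)] at h
    generalize eulerProd (q ^ 2) ^ 2 / eulerProd q = A at *
    generalize eulerProd q ^ 2 * eulerProd (q ^ 6) / (eulerProd (q ^ 2) * eulerProd (q ^ 3)) = X
      at *
    generalize eulerProd (q ^ 3) = Y at *
    have hi : z⁻¹ = 1 - z := by field_simp; linear_combination hz
    have hi3 : (1 - z) ^ 3 = -1 := by linear_combination (2 - z) * hz
    have hu : (1 - z ^ 2) ^ 4 * (1 - z) ^ 4 = 9 := by
      rw [show (1 - z ^ 2) = 2 - z by linear_combination -hz,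
        show (2 - z) ^ 4 = 9 * (1 - z) ^ 2 by linear_combination (z ^ 2 - 7 * z + 7) * hz]
      linear_combination 9 * ((1 - z) ^ 3 - 1) * hi3
    rw [div_eq_mul_inv _ z, div_eq_mul_inv _ (z ^ 2), div_eq_mul_inv _ (z ^ 2), ← inv_pow, hi] at h
    linear_combination h + 8 * A ^ 3 * X * hi3 - X ^ 4 * ((1 - z) ^ 3 - 1) * hi3 + Y ^ 4 * hu
  field_simp at key hI ⊢
  apply mul_left_cancel₀ n6
  linear_combination 9 * eulerProd (q ^ 2) * hI - eulerProd (q ^ 3) * key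
/-- The terms of the series expansion of `-log (a; Q)_∞`. -/
def qPochLogTerm (a Q : ℂ) (k : ℕ) : ℂ := a ^ (k + 1) / ((k + 1) * (1 - Q ^ (k + 1)))

lemma hasSum_neg_log_one_sub {x : ℂ} (hx : ‖x‖ < 1) :
    HasSum (fun k : ℕ => x ^ (k + 1) / ((k : ℂ) + 1)) (-Complex.log (1 - x)) := by
  simpa using (hasSum_nat_add_iff' 1).mpr (Complex.hasSum_taylorSeries_neg_log hx)

/-- The double series expansion of `-log (a; Q)_∞`. -/
def qPochLogDouble (a Q : ℂ) (p : ℕ × ℕ) : ℂ := (a * Q ^ p.1) ^ (p.2 + 1) / ((p.2 : ℂ) + 1)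

lemma summable_qPochLogDouble {a Q : ℂ} (ha : ‖a‖ < 1) (hQ : ‖Q‖ < 1) :
    Summable (qPochLogDouble a Q) := by
  have h1 := summable_geometric_of_lt_one (norm_nonneg Q) hQ
  have h2 := ((summable_geometric_of_lt_one (norm_nonneg a) ha).mul_left ‖a‖)
  refine Summable.of_norm_bounded (h1.mul_of_nonneg h2 (fun _ => by positivity)
    fun _ => by positivity) fun ⟨n, k⟩ => ?_
  have hk : (1 : ℝ) ≤ ‖(k : ℂ) + 1‖ := by
    rw [show (k : ℂ) + 1 = ((k + 1 : ℕ) : ℂ) by push_cast; ring, Complex.norm_natCast]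
    exact_mod_cast Nat.succ_pos k
  simp only [qPochLogDouble, norm_div, norm_mul, norm_pow]
  refine (div_le_self (by positivity) hk).trans ?_
  rw [mul_pow, ← pow_succ', mul_comm]
  gcongr
  rw [← pow_mul]
  exact pow_le_pow_of_le_one (norm_nonneg Q) hQ.le (Nat.le_mul_of_pos_right n k.succ_pos)

lemma hasSum_neg_log_qPoch {a Q : ℂ} (ha : ‖a‖ < 1) (hQ : ‖Q‖ < 1) :
    HasSum (fun n : ℕ => -Complex.log (1 - a * Q ^ n)) (∑' p, qPochLogDouble a Q p) :=
  (summable_qPochLogDouble ha hQ).hasSum.prod_fiberwise fun n =>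
    hasSum_neg_log_one_sub (x := a * Q ^ n) (norm_mul_pow_lt_one ha hQ n)

lemma hasSum_qPochLogTerm {a Q : ℂ} (ha : ‖a‖ < 1) (hQ : ‖Q‖ < 1) :
    HasSum (qPochLogTerm a Q) (∑' p, qPochLogDouble a Q p) := by
  refine ((Equiv.prodComm ℕ ℕ).hasSum_iff.mpr
    (summable_qPochLogDouble ha hQ).hasSum).prod_fiberwise fun k => ?_
  have := (hasSum_geometric_of_norm_lt_one (norm_pow_lt_one hQ (Nat.add_one_ne_zero k))).mul_left
    (a ^ (k + 1) / ((k : ℂ) + 1))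
  rw [show qPochLogTerm a Q k = a ^ (k + 1) / ((k : ℂ) + 1) * (1 - Q ^ (k + 1))⁻¹ by
    rw [qPochLogTerm, ← div_div, div_eq_mul_inv]]
  refine Eq.mp (congrArg (HasSum · _) (funext fun n => ?_)) this
  simp only [qPochLogDouble, Function.comp_apply, Equiv.prodComm_apply, Prod.swap_prod_mk]
  ring

lemma exists_qPoch_eq_exp {a Q : ℂ} (ha : ‖a‖ < 1) (hQ : ‖Q‖ < 1) :
    ∃ s, HasSum (qPochLogTerm a Q) s ∧ qPoch a Q = Complex.exp (-s) := by
  refine ⟨_, hasSum_qPochLogTerm ha hQ, ?_⟩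
  have hneg := (hasSum_neg_log_qPoch ha hQ).neg
  simp only [neg_neg] at hneg
  rw [← hneg.tsum_eq]
  exact (Complex.cexp_tsum_eq_tprod
    (fun n => one_sub_ne_zero_of_norm_lt_one (norm_mul_pow_lt_one ha hQ n)) hneg.summable).symm

/-- The terms of the series obtained from `log (θ(qz)⁴ / (θ(qz²) θ(q)³))`, to base `q²`, by removing
the factor `(z - 1)⁴`. -/
def quarticTerm (q z : ℂ) (k : ℕ) : ℂ :=
  q ^ (k + 1) / ((k + 1) * (1 - (q ^ 2) ^ (k + 1))) *
    ((∑ i ∈ Finset.range (k + 1), z ^ i) ^ 4 / (z ^ (k + 1)) ^ 2)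

lemma theta_odd {q z : ℂ} (hq0 : q ≠ 0) (hq : ‖q‖ < 1) (hz : z ≠ 0) :
    theta (q ^ 2) (q * z) = qPoch (q * z) (q ^ 2) * qPoch (q / z) (q ^ 2) * eulerProd (q ^ 2) := by
  rw [theta_eq (pow_ne_zero 2 hq0) (norm_pow_lt_one hq two_ne_zero) (mul_ne_zero hq0 hz),
    show q ^ 2 / (q * z) = q / z by field_simp]

lemma theta_quotient_eq_exp {q z : ℂ} (hq0 : q ≠ 0) (hq : ‖q‖ < 1) (hz : ‖z‖ = 1) :
    theta (q ^ 2) (q * z ^ 2) * theta (q ^ 2) q ^ 3 = theta (q ^ 2) (q * z) ^ 4 *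
      Complex.exp (-((z - 1) ^ 4 * ∑' k, quarticTerm q z k)) := by
  have hz0 : z ≠ 0 := by rintro rfl; simp at hz
  have hQ : ‖q ^ 2‖ < 1 := norm_pow_lt_one hq two_ne_zero
  obtain ⟨s₁, h₁, e₁⟩ := exists_qPoch_eq_exp (a := q * z ^ 2) (by simpa [hz]) hQ
  obtain ⟨s₂, h₂, e₂⟩ := exists_qPoch_eq_exp (a := q / z ^ 2) (by simpa [hz]) hQ
  obtain ⟨s₃, h₃, e₃⟩ := exists_qPoch_eq_exp (a := q) hq hQ
  obtain ⟨s₄, h₄, e₄⟩ := exists_qPoch_eq_exp (a := q * z) (by simpa [hz]) hQ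
  obtain ⟨s₅, h₅, e₅⟩ := exists_qPoch_eq_exp (a := q / z) (by simpa [hz]) hQ
  have hs := ((h₁.add h₂).add (h₃.mul_left 6)).sub ((h₄.add h₅).mul_left 4)
  have hterm (k : ℕ) : qPochLogTerm (q * z ^ 2) (q ^ 2) k + qPochLogTerm (q / z ^ 2) (q ^ 2) k +
      6 * qPochLogTerm q (q ^ 2) k -
      4 * (qPochLogTerm (q * z) (q ^ 2) k + qPochLogTerm (q / z) (q ^ 2) k) =
      (z - 1) ^ 4 * quarticTerm q z k := by
    have hg := geom_sum_mul z (k + 1)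
    have hzk : z ^ (k + 1) ≠ 0 := pow_ne_zero _ hz0
    have h4 : (z - 1) ^ 4 * (∑ i ∈ Finset.range (k + 1), z ^ i) ^ 4 = (z ^ (k + 1) - 1) ^ 4 := by
      rw [← hg]; ring
    simp only [qPochLogTerm, quarticTerm, mul_pow, div_pow, pow_right_comm z 2 (k + 1)]
    rw [mul_left_comm, ← mul_div_assoc ((z - 1) ^ 4), h4]
    generalize z ^ (k + 1) = u at *
    field_simp
    ring
  rw [tsum_mul_left.symm, ← tsum_congr hterm, hs.tsum_eq, theta_odd hq0 hq hz0,
    theta_odd hq0 hq (pow_ne_zero 2 hz0),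
    show theta (q ^ 2) q = theta (q ^ 2) (q * 1) by rw [mul_one],
    theta_odd hq0 hq one_ne_zero, mul_one, div_one, e₁, e₂, e₃, e₄, e₅]
  simp only [mul_pow, ← Complex.exp_nat_mul]
  have : Complex.exp (-s₁) * Complex.exp (-s₂) * (Complex.exp (↑3 * -s₃) * Complex.exp (↑3 * -s₃)) =
      Complex.exp (↑4 * -s₄) * Complex.exp (↑4 * -s₅) *
        Complex.exp (-(s₁ + s₂ + 6 * s₃ - 4 * (s₄ + s₅))) := by
    simp only [← Complex.exp_add]
    congr 1
    ring
  push_cast at this ⊢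
  linear_combination eulerProd (q ^ 2) ^ 4 * this

lemma theta_odd_pow_four {q z : ℂ} (hq0 : q ≠ 0) (hq : ‖q‖ < 1) (hz : z ≠ 0) :
    theta (q ^ 2) (q * z ^ 2) * theta (q ^ 2) q ^ 3 =
      theta (q ^ 2) (q * z) ^ 4 - q / z ^ 2 * theta (q ^ 2) z ^ 4 := by
  have hQ0 : q ^ 2 ≠ 0 := pow_ne_zero 2 hq0
  have hqz : q * z ≠ 0 := mul_ne_zero hq0 hz
  have h := theta_three_term hQ0 (norm_pow_lt_one hq two_ne_zero) hqz hz hq0 one_ne_zero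
  rw [show q * z * z = q * z ^ 2 by ring, show q * z / z = q by field_simp,
    show q * z * q = q ^ 2 * z by ring, show q * z / q = z by field_simp,
    show z * q = q * z by ring, show z / q = (q ^ 2 / (q * z))⁻¹ by field_simp,
    theta_inv (div_ne_zero hQ0 hqz), theta_base_div hQ0 hqz, theta_mul_base hQ0 hz] at h
  simp only [mul_one, div_one] at h
  field_simp at h ⊢
  linear_combination h

lemma norm_quarticTerm_le {q z : ℂ} (hq : ‖q‖ < 1) (hz : ‖z‖ = 1) (k : ℕ) :
    ‖quarticTerm q z k‖ ≤ (1 - ‖q‖)⁻¹ * (((k + 1 : ℕ) : ℝ) ^ 3 * ‖q‖ ^ (k + 1)) := by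
  have hG : ‖∑ i ∈ Finset.range (k + 1), z ^ i‖ ≤ ((k + 1 : ℕ) : ℝ) := by
    refine (norm_sum_le _ _).trans ?_
    simp [hz]
  have hd : 1 - ‖q‖ ≤ ‖1 - (q ^ 2) ^ (k + 1)‖ := by
    refine le_trans ?_ (norm_sub_norm_le _ _)
    rw [norm_one, norm_pow, norm_pow, ← pow_mul]
    have := pow_le_of_le_one (norm_nonneg q) hq.le (show 2 * (k + 1) ≠ 0 by omega)
    linarith
  have hd0 : 0 < 1 - ‖q‖ := by linarith
  have hk : ‖(k : ℂ) + 1‖ = ((k + 1 : ℕ) : ℝ) := by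
    rw [← Complex.norm_natCast]; push_cast; rfl
  have hk0 : (0 : ℝ) < ((k + 1 : ℕ) : ℝ) := by positivity
  rw [quarticTerm]
  simp only [norm_mul, norm_div, norm_pow, hz, one_pow, div_one, hk] at hd ⊢
  calc _ ≤ ‖q‖ ^ (k + 1) / (((k + 1 : ℕ) : ℝ) * (1 - ‖q‖)) * ((k + 1 : ℕ) : ℝ) ^ 4 := by
        gcongr
    _ = _ := by field_simp

lemma tendsto_tsum_quarticTerm {q : ℂ} (hq : ‖q‖ < 1) {l : Filter ℝ} {z : ℝ → ℂ}
    (hz : ∀ t, ‖z t‖ = 1) (hl : Tendsto z l (𝓝 1)) :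
    Tendsto (fun t => ∑' k, quarticTerm q (z t) k) l (𝓝 (∑' k, quarticTerm q 1 k)) := by
  refine tendsto_tsum_of_dominated_convergence ?_ (fun k => ?_)
    (Eventually.of_forall fun t k => norm_quarticTerm_le hq (hz t) k)
  · have := summable_pow_mul_geometric_of_norm_lt_one 3 (r := ‖q‖) (by simpa using hq)
    exact ((summable_nat_add_iff 1).mpr this).mul_left _
  · have : ContinuousAt (fun z => quarticTerm q z k) 1 := by
      unfold quarticTerm
      fun_prop (disch := simp)
    exact this.tendsto.comp hl

/-- The Lambert series for the eighth power of `ψ`. -/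
lemma tsum_quarticTerm_one {q : ℂ} (hq0 : q ≠ 0) (hq : ‖q‖ < 1) :
    ∑' k, quarticTerm q 1 k = q * (eulerProd (q ^ 2) ^ 2 / eulerProd q) ^ 8 := by
  let z : ℝ → ℂ := fun t => (1 + t * Complex.I) / (1 - t * Complex.I)
  have hden (t : ℝ) : (1 : ℂ) - t * Complex.I ≠ 0 := fun h => by
    simpa using congrArg Complex.re h
  have hz (t : ℝ) : ‖z t‖ = 1 := by
    have : (1 : ℂ) + t * Complex.I = (starRingEnd ℂ) (1 - t * Complex.I) := by simp
    rw [norm_div, this, Complex.norm_conj, div_self (norm_ne_zero_iff.mpr (hden t))]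
  have hz0 (t : ℝ) : z t ≠ 0 := norm_ne_zero_iff.mp (by simp [hz])
  have hzt : Tendsto z (𝓝[≠] 0) (𝓝 1) := by
    have : ContinuousAt z 0 := by
      have := hden 0
      fun_prop (disch := assumption)
    have h := this.tendsto
    simp only [z, Complex.ofReal_zero, zero_mul, add_zero, sub_zero, div_one] at h
    exact h.mono_left nhdsWithin_le_nhds
  have hz1 (t : ℝ) (ht : t ≠ 0) : z t - 1 ≠ 0 := by
    rw [show z t - 1 = 2 * t * Complex.I / (1 - t * Complex.I) by
      simp only [z]; field_simp [hden t]; ring]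
    exact div_ne_zero (by simp [ht]) (hden t)
  have hQ : ‖q ^ 2‖ < 1 := norm_pow_lt_one hq two_ne_zero
  have hQ0 : q ^ 2 ≠ 0 := pow_ne_zero 2 hq0
  have hc := continuous_qPoch hQ
  have hlim := tendsto_tsum_quarticTerm hq hz hzt
  have hP (a : ℂ) : Tendsto (fun t => qPoch (a * z t) (q ^ 2)) (𝓝[≠] 0) (𝓝 (qPoch a (q ^ 2))) := by
    have h : Tendsto (fun t => a * z t) (𝓝[≠] 0) (𝓝 a) := by simpa using hzt.const_mul a
    exact (hc.tendsto a).comp h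
  have hP' (a : ℂ) : Tendsto (fun t => qPoch (a / z t) (q ^ 2)) (𝓝[≠] 0) (𝓝 (qPoch a (q ^ 2))) := by
    have h : Tendsto (fun t => a / z t) (𝓝[≠] 0) (𝓝 a) := by
      have h := (tendsto_const_nhds (x := a)).div hzt one_ne_zero
      rw [div_one] at h
      exact h
    exact (hc.tendsto a).comp h
  have hw : Tendsto (fun t => -((z t - 1) ^ 4 * ∑' k, quarticTerm q (z t) k)) (𝓝[≠] 0) (𝓝 0) := by
    simpa using (((hzt.sub_const 1).pow 4).mul hlim).neg
  have hD : Tendsto (fun t => dslope Complex.exp 0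
      (-((z t - 1) ^ 4 * ∑' k, quarticTerm q (z t) k))) (𝓝[≠] 0) (𝓝 1) := by
    have h : ContinuousAt (dslope Complex.exp 0) 0 :=
      continuousAt_dslope_same.mpr Complex.differentiableAt_exp
    have h' := h.tendsto.comp hw
    rw [dslope_same, Complex.deriv_exp, Complex.exp_zero] at h'
    exact h'
  have key : ∀ t : ℝ, t ≠ 0 →
      (qPoch (q * z t) (q ^ 2) * qPoch (q / z t) (q ^ 2)) ^ 4 *
        ((∑' k, quarticTerm q (z t) k) * dslope Complex.exp 0
          (-((z t - 1) ^ 4 * ∑' k, quarticTerm q (z t) k))) =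
      q / z t ^ 2 * (qPoch (q ^ 2 * z t) (q ^ 2) * qPoch (q ^ 2 / z t) (q ^ 2)) ^ 4 := by
    intro t ht
    have h1 := theta_quotient_eq_exp hq0 hq (hz t)
    rw [theta_odd_pow_four hq0 hq (hz0 t), theta_odd hq0 hq (hz0 t),
      theta_eq hQ0 hQ (hz0 t), qPoch_eq_one_sub_mul (z t) hQ, mul_comm (z t) (q ^ 2)] at h1
    have h2 := sub_smul_dslope Complex.exp 0 (-((z t - 1) ^ 4 * ∑' k, quarticTerm q (z t) k))
    rw [smul_eq_mul, Complex.exp_zero, sub_zero] at h2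
    have hE := pow_ne_zero 4 (eulerProd_ne_zero hQ)
    have hzt1 := hz1 t ht
    apply mul_left_cancel₀ (mul_ne_zero hE (pow_ne_zero 4 hzt1))
    generalize z t = w at h1 h2 hzt1 ⊢
    linear_combination h1 - eulerProd (q ^ 2) ^ 4 *
      (qPoch (q * w) (q ^ 2) * qPoch (q / w) (q ^ 2)) ^ 4 * h2
  have hL := (((hP q).mul (hP' q)).pow 4).mul (hlim.mul hD)
  have hR := ((tendsto_const_nhds (x := q)).div (hzt.pow 2) (by simp)).mul
    (((hP (q ^ 2)).mul (hP' (q ^ 2))).pow 4)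
  have h := tendsto_nhds_unique hL
    (hR.congr' (eventually_nhdsWithin_of_forall fun t ht => (key t ht).symm))
  have e1 := eulerProd_sq_eq hq
  have n1 := eulerProd_ne_zero hq
  have n2 := eulerProd_ne_zero hQ
  have hp : qPoch q (q ^ 2) = eulerProd q / eulerProd (q ^ 2) := by rw [e1]; field_simp
  rw [hp, show qPoch (q ^ 2) (q ^ 2) = eulerProd (q ^ 2) from rfl] at h
  simp only [one_pow, div_one, mul_one] at h
  field_simp at h ⊢
  linear_combination h
lemma quarticTerm_one (q : ℂ) (k : ℕ) :
    quarticTerm q 1 k = ((k : ℂ) + 1) ^ 3 * q ^ (k + 1) / (1 - (q ^ 2) ^ (k + 1)) := by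
  have : (k : ℂ) + 1 ≠ 0 := by exact_mod_cast k.succ_ne_zero
  rw [quarticTerm]
  simp only [one_pow, Finset.sum_const, Finset.card_range, nsmul_eq_mul, mul_one, div_one]
  push_cast
  rw [← div_div]
  field_simp

lemma summable_quarticTerm_one {q : ℂ} (hq : ‖q‖ < 1) : Summable (quarticTerm q 1) := by
  have := summable_pow_mul_geometric_of_norm_lt_one 3 (r := ‖q‖) (by simpa using hq)
  exact Summable.of_norm_bounded (((summable_nat_add_iff 1).mpr this).mul_left _)
    (norm_quarticTerm_le hq norm_one)

lemma lambert_sub_eq_quarticTerm {q : ℂ} (hq : ‖q‖ < 1) (j : ℕ) :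
    ((j : ℂ) + 1) ^ 3 * q ^ (j + 1) / (1 - q ^ (j + 1)) -
      ((j : ℂ) + 1) ^ 3 * (q ^ 2) ^ (j + 1) / (1 - (q ^ 2) ^ (j + 1)) = quarticTerm q 1 j := by
  have hx := norm_pow_lt_one hq j.add_one_ne_zero
  rw [quarticTerm_one, pow_right_comm q 2]
  generalize q ^ (j + 1) = x at *
  have h1 : 1 - x ≠ 0 := one_sub_ne_zero_of_norm_lt_one hx
  have h2 : 1 - x ^ 2 ≠ 0 := one_sub_ne_zero_of_norm_lt_one (norm_pow_lt_one hx two_ne_zero)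
  field_simp
  ring

lemma tprod_one_sub_pow_sq {q : ℂ} (hq : ‖q‖ < 1) {k : ℕ} (hk : k ≠ 0) :
    Multipliable (fun n : ℕ => (1 - q ^ (k * (n + 1))) ^ 2) ∧
      ∏' n : ℕ, (1 - q ^ (k * (n + 1))) ^ 2 = eulerProd (q ^ k) ^ 2 := by
  have h := multipliable_qPoch (q ^ k) (norm_pow_lt_one hq hk)
  have hn (n : ℕ) : (1 - q ^ (k * (n + 1))) ^ 2 =
      (1 - q ^ k * (q ^ k) ^ n) * (1 - q ^ k * (q ^ k) ^ n) := by
    rw [pow_mul, pow_succ' (q ^ k), sq]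
  simp only [hn]
  exact ⟨h.mul h, by rw [h.tprod_mul h, sq]; rfl⟩

lemma tprod_eta_eq {q : ℂ} (hq : ‖q‖ < 1) :
    ∏' n : ℕ, ((1 - q ^ (1 * (n + 1))) ^ 2 * (1 - q ^ (2 * (n + 1))) ^ 2 *
      (1 - q ^ (3 * (n + 1))) ^ 2 * (1 - q ^ (6 * (n + 1))) ^ 2) =
      eulerProd q ^ 2 * eulerProd (q ^ 2) ^ 2 * eulerProd (q ^ 3) ^ 2 * eulerProd (q ^ 6) ^ 2 := by
  obtain ⟨m₁, p₁⟩ := tprod_one_sub_pow_sq hq one_ne_zero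
  obtain ⟨m₂, p₂⟩ := tprod_one_sub_pow_sq hq two_ne_zero
  obtain ⟨m₃, p₃⟩ := tprod_one_sub_pow_sq hq three_ne_zero
  obtain ⟨m₆, p₆⟩ := tprod_one_sub_pow_sq hq (show 6 ≠ 0 by norm_num)
  rw [((m₁.mul m₂).mul m₃).tprod_mul m₆, (m₁.mul m₂).tprod_mul m₃, m₁.tprod_mul m₂, p₁, p₂, p₃, p₆,
    pow_one]

theorem statement14 (q : ℂ) (hq : ‖q‖ < 1) :
    q ^ 2 * (∑' n : ℕ, (q) ^ (n * (n + 1) / 2)) ^ 4 * (∑' n : ℕ, (q ^ 3) ^ (n * (n + 1) / 2)) ^ 4 =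
      (1 / 10) * ∑' j : ℕ,
        (((j : ℂ) + 1) ^ 3 * q ^ (1 * (j + 1)) / (1 - q ^ (1 * (j + 1))) - ((j : ℂ) + 1) ^ 3 * q ^ (2 * (j + 1)) / (1 - q ^ (2 * (j + 1))) + 9 * ((j : ℂ) + 1) ^ 3 * q ^ (3 * (j + 1)) / (1 - q ^ (3 * (j + 1))) - 9 * ((j : ℂ) + 1) ^ 3 * q ^ (6 * (j + 1)) / (1 - q ^ (6 * (j + 1))))
        - (1 / 10) * (q * (∏' n : ℕ, ((1 - q ^ (1 * (n + 1))) ^ 2 * (1 - q ^ (2 * (n + 1))) ^ 2 * (1 - q ^ (3 * (n + 1))) ^ 2 * (1 - q ^ (6 * (n + 1))) ^ 2))) := by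
  rcases eq_or_ne q 0 with rfl | hq0
  · simp
  have hq3 : ‖q ^ 3‖ < 1 := norm_pow_lt_one hq three_ne_zero
  have hlambert (j : ℕ) :
      ((j : ℂ) + 1) ^ 3 * q ^ (1 * (j + 1)) / (1 - q ^ (1 * (j + 1))) -
        ((j : ℂ) + 1) ^ 3 * q ^ (2 * (j + 1)) / (1 - q ^ (2 * (j + 1))) +
        9 * ((j : ℂ) + 1) ^ 3 * q ^ (3 * (j + 1)) / (1 - q ^ (3 * (j + 1))) -
        9 * ((j : ℂ) + 1) ^ 3 * q ^ (6 * (j + 1)) / (1 - q ^ (6 * (j + 1))) =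
      quarticTerm q 1 j + 9 * quarticTerm (q ^ 3) 1 j := by
    rw [← lambert_sub_eq_quarticTerm hq, ← lambert_sub_eq_quarticTerm hq3, one_mul,
      pow_mul q 2, pow_mul q 3, pow_mul q 6, ← pow_mul q 3 2]
    ring
  have hsum : ∑' j, (quarticTerm q 1 j + 9 * quarticTerm (q ^ 3) 1 j) =
      q * (eulerProd (q ^ 2) ^ 2 / eulerProd q) ^ 8 +
        9 * (q ^ 3 * (eulerProd (q ^ 6) ^ 2 / eulerProd (q ^ 3)) ^ 8) := by
    rw [(summable_quarticTerm_one hq).tsum_add ((summable_quarticTerm_one hq3).mul_left 9),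
      tsum_mul_left, tsum_quarticTerm_one hq0 hq, tsum_quarticTerm_one (pow_ne_zero 3 hq0) hq3,
      ← pow_mul q 3 2]
  rw [tsum_congr hlambert, hsum, psi_eq hq0 hq, psi_eq (pow_ne_zero 3 hq0) hq3, tprod_eta_eq hq,
    ← pow_mul q 3 2]
  have hprod :
      eulerProd (q ^ 2) ^ 3 * eulerProd (q ^ 3) ^ 5 / (eulerProd q ^ 3 * eulerProd (q ^ 6)) *
      (eulerProd q ^ 5 * eulerProd (q ^ 6) ^ 3 / (eulerProd (q ^ 2) * eulerProd (q ^ 3) ^ 3)) =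
      eulerProd q ^ 2 * eulerProd (q ^ 2) ^ 2 * eulerProd (q ^ 3) ^ 2 * eulerProd (q ^ 6) ^ 2 := by
    have h1 := eulerProd_ne_zero hq
    have h2 := eulerProd_ne_zero (norm_pow_lt_one hq two_ne_zero)
    have h3 := eulerProd_ne_zero hq3
    have h6 := eulerProd_ne_zero (norm_pow_lt_one hq (show 6 ≠ 0 by norm_num))
    field_simp
  rw [← psi_pow_four_sub hq0 hq, ← psi_pow_four_sub_nine hq0 hq] at hprod
  linear_combination (-q / 10) * hprod
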